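/- If p: ℝ^n → ℝ is a positive hyperbolic polynomial (homogeneous of degree m, positive on the positive orthant, and t ↦ p(x + t·u) has m real roots for every u > 0 and every x), then every coefficient of every monomial of p is nonnegative. -/

import Mathlib

open MvPolynomial Polynomial

/-- The restriction of the multivariate polynomial `p` to the line `t ↦ x + t • u`,
as a univariate real polynomial in `t`. -/
noncomputable def linePoly {n : ℕ} (p : MvPolynomial (Fin n) ℝ) (x u : Fin n → ℝ) :
    Polynomial ℝ :=
  MvPolynomial.aeval (fun i => Polynomial.C (x i) + Polynomial.C (u i) * Polynomial.X) p

theorem MvPolynomial.IsHomogeneous.aeval_mul {σ A : Type*} [CommRing A] [Algebra ℝ A]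
    {p : MvPolynomial σ ℝ} {m : ℕ} (hp : p.IsHomogeneous m) (r : A) (z : σ → A) :
    MvPolynomial.aeval (fun i => r * z i) p = r ^ m * MvPolynomial.aeval z p := by
  simp only [MvPolynomial.aeval_def, MvPolynomial.eval₂_eq, Finset.mul_sum, mul_pow,
    Finset.prod_mul_distrib]
  refine Finset.sum_congr rfl fun d hd => ?_
  have hdeg : ∑ i ∈ d.support, d i = m := by
    rw [← Finsupp.degree_apply, Finsupp.degree_eq_weight_one]
    exact hp (MvPolynomial.mem_support_iff.mp hd)
  rw [Finset.prod_pow_eq_pow_sum, hdeg]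
  ring

/-- The derivative of a multivariate polynomial in the direction `v`. -/
noncomputable def MvPolynomial.dirDeriv {n : ℕ} (v : Fin n → ℝ) (p : MvPolynomial (Fin n) ℝ) :
    MvPolynomial (Fin n) ℝ :=
  ∑ i, MvPolynomial.C (v i) * MvPolynomial.pderiv i p

theorem MvPolynomial.IsHomogeneous.dirDeriv {n m : ℕ} {p : MvPolynomial (Fin n) ℝ}
    (hp : p.IsHomogeneous m) (v : Fin n → ℝ) : (p.dirDeriv v).IsHomogeneous (m - 1) := by
  refine MvPolynomial.IsHomogeneous.sum _ _ _ fun i _ => ?_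
  simpa using (MvPolynomial.isHomogeneous_C (Fin n) (v i)).mul hp.pderiv

theorem MvPolynomial.dirDeriv_mul_X {n : ℕ} (v : Fin n → ℝ) (p : MvPolynomial (Fin n) ℝ)
    (j : Fin n) : (p * MvPolynomial.X j).dirDeriv v =
      p.dirDeriv v * MvPolynomial.X j + MvPolynomial.C (v j) * p := by
  simp [MvPolynomial.dirDeriv, MvPolynomial.pderiv_X, mul_add, Finset.sum_add_distrib,
    Finset.mul_sum, Pi.single_apply, mul_left_comm, mul_comm, add_comm]

/-- The chain rule along a line. -/
theorem MvPolynomial.derivative_aeval_line {n : ℕ} (p : MvPolynomial (Fin n) ℝ)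
    (z : Fin n → ℂ) (v : Fin n → ℝ) :
    derivative (MvPolynomial.aeval
      (fun i => Polynomial.C (z i) + Polynomial.C (v i : ℂ) * Polynomial.X) p) =
    MvPolynomial.aeval
      (fun i => Polynomial.C (z i) + Polynomial.C (v i : ℂ) * Polynomial.X) (p.dirDeriv v) := by
  induction p using MvPolynomial.induction_on with
  | C a => simp [MvPolynomial.dirDeriv, Polynomial.algebraMap_apply]
  | add p q hp hq =>
    simp only [MvPolynomial.dirDeriv, map_add, map_sum, mul_add, Finset.sum_add_distrib] at *
    rw [hp, hq]
  | mul_X p j hp =>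
    rw [MvPolynomial.dirDeriv_mul_X, map_mul, Polynomial.derivative_mul, hp]
    have hC : (MvPolynomial.aeval
        fun i => Polynomial.C (z i) + Polynomial.C (v i : ℂ) * Polynomial.X)
        (MvPolynomial.C (v j)) = Polynomial.C (v j : ℂ) := by
      simp [Polynomial.algebraMap_apply]
    rw [map_add, map_mul, map_mul, hC, MvPolynomial.aeval_X, Polynomial.derivative_add,
      Polynomial.derivative_C, Polynomial.derivative_C_mul, Polynomial.derivative_X]
    ring

/-- A homogeneous real polynomial of degree `m` that is positive on the positive orthant and has
no zero on the product of open upper half planes. -/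
structure IsPositiveStable {n : ℕ} (m : ℕ) (p : MvPolynomial (Fin n) ℝ) : Prop where
  hom : p.IsHomogeneous m
  pos : ∀ x : Fin n → ℝ, (∀ i, 0 < x i) → 0 < MvPolynomial.eval x p
  ne_zero : ∀ z : Fin n → ℂ, (∀ i, 0 < (z i).im) → MvPolynomial.aeval z p ≠ 0

theorem MvPolynomial.aeval_ofReal {n : ℕ} (p : MvPolynomial (Fin n) ℝ) (x : Fin n → ℝ) :
    MvPolynomial.aeval (fun i => (x i : ℂ)) p = (MvPolynomial.eval x p : ℂ) := by
  have h := MvPolynomial.aeval_algebraMap_apply ℂ x p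
  simpa [MvPolynomial.aeval_eq_eval, Function.comp_def] using h

theorem MvPolynomial.eval_aeval_line {n : ℕ} (p : MvPolynomial (Fin n) ℝ)
    (z w : Fin n → ℂ) (s : ℂ) :
    (MvPolynomial.aeval (fun i => Polynomial.C (z i) + Polynomial.C (w i) * Polynomial.X) p).eval s
      = MvPolynomial.aeval (fun i => z i + w i * s) p := by
  induction p using MvPolynomial.induction_on with
  | C a => simp [Polynomial.algebraMap_apply]
  | add p q hp hq => simp [hp, hq]
  | mul_X p j hp => simp [hp]

theorem IsPositiveStable.degree_aeval_line_pos {n m : ℕ} {p : MvPolynomial (Fin n) ℝ}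
    (hp : IsPositiveStable (m + 1) p) (z : Fin n → ℂ) {v : Fin n → ℝ} (hv : ∀ i, 0 < v i) :
    0 < (MvPolynomial.aeval
      (fun i => Polynomial.C (z i) + Polynomial.C (v i : ℂ) * Polynomial.X) p).degree := by
  by_contra! hdeg
  have hconst := Polynomial.eq_C_of_degree_le_zero hdeg
  set c := (MvPolynomial.aeval
      (fun i => Polynomial.C (z i) + Polynomial.C (v i : ℂ) * Polynomial.X) p).coeff 0
  have hline (s : ℂ) : MvPolynomial.aeval (fun i => z i + v i * s) p = c := by
    rw [← MvPolynomial.eval_aeval_line, hconst, Polynomial.eval_C]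
  set A := MvPolynomial.aeval
    (fun i => Polynomial.C (v i : ℂ) + Polynomial.C (z i) * Polynomial.X) p with hA
  have hX : Polynomial.X * (A - Polynomial.C c * Polynomial.X ^ (m + 1)) = 0 := by
    refine Polynomial.funext fun r => ?_
    rcases eq_or_ne r 0 with rfl | hr
    · simp
    have h : MvPolynomial.aeval (fun i => v i + z i * r) p = r ^ (m + 1) * c := by
      rw [← hline r⁻¹, ← hp.hom.aeval_mul]
      congr 2 with i
      field_simp
      ring
    rw [Polynomial.eval_mul, Polynomial.eval_sub, hA, MvPolynomial.eval_aeval_line, h]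
    simp [mul_comm c]
  have hA0 := sub_eq_zero.mp ((mul_eq_zero.mp hX).resolve_left Polynomial.X_ne_zero)
  have h0 := congrArg (Polynomial.eval 0) hA0
  rw [hA, MvPolynomial.eval_aeval_line] at h0
  simp [MvPolynomial.aeval_ofReal] at h0
  exact (hp.pos v hv).ne' h0

theorem IsPositiveStable.dirDeriv {n m : ℕ} {p : MvPolynomial (Fin n) ℝ}
    (hp : IsPositiveStable (m + 1) p) {v : Fin n → ℝ} (hv : ∀ i, 0 < v i) :
    IsPositiveStable m (p.dirDeriv v) := by
  have hom : (p.dirDeriv v).IsHomogeneous m := hp.hom.dirDeriv v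
  have hne : ∀ z : Fin n → ℂ, (∀ i, 0 < (z i).im) →
      MvPolynomial.aeval z (p.dirDeriv v) ≠ 0 := by
    intro z hz h0
    set Q := MvPolynomial.aeval
      (fun i => Polynomial.C (z i) + Polynomial.C (v i : ℂ) * Polynomial.X) p with hQ
    have hdeg : 0 < Q.degree := hp.degree_aeval_line_pos z hv
    have hroots : Q.rootSet ℂ ⊆ {s : ℂ | s.im < 0} := by
      intro s hs
      by_contra hs'
      have hs0 : 0 ≤ s.im := not_lt.mp hs'
      refine hp.ne_zero (fun i => z i + v i * s) (fun i => ?_) ?_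
      · have := mul_nonneg (hv i).le hs0
        simpa using add_pos_of_pos_of_nonneg (hz i) this
      · rw [← MvPolynomial.eval_aeval_line, ← hQ]
        simpa using (Polynomial.mem_rootSet.mp hs).2
    have hd0 : derivative Q ≠ 0 := fun h =>
      hdeg.not_ge (Polynomial.degree_le_zero_iff.mpr (Polynomial.eq_C_of_derivative_eq_zero h))
    have hmem : (0 : ℂ) ∈ (derivative Q).rootSet ℂ := by
      refine Polynomial.mem_rootSet.mpr ⟨hd0, ?_⟩
      rw [hQ, MvPolynomial.derivative_aeval_line, Polynomial.coe_aeval_eq_eval,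
        MvPolynomial.eval_aeval_line]
      simpa using h0
    have := convexHull_min hroots (convex_halfSpace_im_lt 0)
      (Polynomial.rootSet_derivative_subset_convexHull_rootSet hdeg hmem)
    simp at this
  have hne' : ∀ x : Fin n → ℝ, (∀ i, 0 < x i) → MvPolynomial.eval x (p.dirDeriv v) ≠ 0 := by
    intro x hx h0
    refine hne (fun i => Complex.I * x i) (fun i => by simpa using hx i) ?_
    rw [hom.aeval_mul, MvPolynomial.aeval_ofReal, h0]
    simp
  have hvpos : 0 < MvPolynomial.eval v (p.dirDeriv v) := by
    have h := congrArg (MvPolynomial.eval v) hp.hom.sum_X_mul_pderiv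
    have h' : MvPolynomial.eval v (p.dirDeriv v) = (m + 1 : ℕ) * MvPolynomial.eval v p := by
      simpa [MvPolynomial.dirDeriv] using h
    rw [h']
    exact mul_pos (by positivity) (hp.pos v hv)
  refine ⟨hom, fun x hx => ?_, hne⟩
  by_contra! hneg
  have hconv : Convex ℝ {y : Fin n → ℝ | ∀ i, 0 < y i} := by
    have : {y : Fin n → ℝ | ∀ i, 0 < y i} = Set.univ.pi fun _ => Set.Ioi 0 := by
      ext; simp
    rw [this]
    exact convex_pi fun _ _ => convex_Ioi 0
  obtain ⟨y, hy, hy0⟩ := hconv.isPreconnected.intermediate_value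
    (f := fun y => MvPolynomial.eval y (p.dirDeriv v)) hx hv
    (MvPolynomial.continuous_eval _).continuousOn ⟨hneg, hvpos.le⟩
  exact hne' y hy hy0

theorem nonneg_of_forall_add_mul_nonneg {a b : ℝ} (h : ∀ ε > 0, 0 ≤ a + ε * b) : 0 ≤ a := by
  have hcont : Filter.Tendsto (fun ε : ℝ => a + ε * b) (nhdsWithin 0 (Set.Ioi 0)) (nhds a) := by
    have : Continuous fun ε : ℝ => a + ε * b := by fun_prop
    simpa using (this.tendsto 0).mono_left nhdsWithin_le_nhds
  exact ge_of_tendsto hcont (Filter.eventually_of_mem self_mem_nhdsWithin h)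

theorem IsPositiveStable.coeff_nonneg {n m : ℕ} {p : MvPolynomial (Fin n) ℝ}
    (hp : IsPositiveStable m p) (d : Fin n →₀ ℕ) : 0 ≤ p.coeff d := by
  induction m generalizing p d with
  | zero =>
    obtain ⟨c, rfl⟩ : ∃ c, p = MvPolynomial.C c :=
      ⟨_, MvPolynomial.totalDegree_eq_zero_iff_eq_C.mp (Nat.le_zero.mp hp.hom.totalDegree_le)⟩
    have hc : 0 < c := by simpa using hp.pos (fun _ => 1) fun _ => one_pos
    rw [MvPolynomial.coeff_C]
    split_ifs <;> positivity
  | succ m ih =>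
    by_cases hd : p.coeff d = 0
    · exact hd.ge
    have hdeg : d.degree = m + 1 := by
      rw [Finsupp.degree_eq_weight_one]
      exact hp.hom hd
    obtain ⟨i, hi⟩ : ∃ i, d i ≠ 0 := by
      by_contra! h
      obtain rfl : d = 0 := Finsupp.ext h
      simp at hdeg
    obtain ⟨e, rfl⟩ : ∃ e, d = e + Finsupp.single i 1 :=
      ⟨d - Finsupp.single i 1, (tsub_add_cancel_of_le (by simpa [Nat.one_le_iff_ne_zero] using hi)).symm⟩
    have key : 0 ≤ (MvPolynomial.pderiv i p).coeff e := by
      refine nonneg_of_forall_add_mul_nonneg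
        (b := ∑ j, (MvPolynomial.pderiv j p).coeff e) fun ε hε => ?_
      have hsingle : (0 : Fin n → ℝ) ≤ Pi.single i 1 := Pi.single_nonneg.mpr zero_le_one
      have hv (j : Fin n) : 0 < (Pi.single i 1 : Fin n → ℝ) j + ε :=
        add_pos_of_nonneg_of_pos (hsingle j) hε
      have h := ih (hp.dirDeriv hv) e
      simpa [MvPolynomial.dirDeriv, MvPolynomial.coeff_sum, add_mul, Finset.sum_add_distrib,
        Pi.single_apply, Finset.mul_sum] using h
    rw [MvPolynomial.coeff_pderiv] at key
    exact nonneg_of_mul_nonneg_left key (by positivity)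

theorem aeval_linePoly {n : ℕ} (p : MvPolynomial (Fin n) ℝ) (x u : Fin n → ℝ) (s : ℂ) :
    Polynomial.aeval s (linePoly p x u) = MvPolynomial.aeval (fun i => x i + u i * s) p := by
  unfold linePoly
  induction p using MvPolynomial.induction_on with
  | C a => simp
  | add p q hp hq => simp [hp, hq]
  | mul_X p j hp => simp [hp]

theorem linePoly_ne_zero {n : ℕ} {p : MvPolynomial (Fin n) ℝ}
    (hpos : ∀ x : Fin n → ℝ, (∀ i, 0 < x i) → 0 < MvPolynomial.eval x p)
    (x : Fin n → ℝ) {u : Fin n → ℝ} (hu : ∀ i, 0 < u i) : linePoly p x u ≠ 0 := by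
  intro h
  have hlarge : ∀ᶠ t : ℝ in Filter.atTop, ∀ i, 0 < x i + u i * t :=
    Filter.eventually_all.mpr fun i =>
      (Filter.tendsto_atTop_add_const_left _ (x i)
        (Filter.tendsto_id.const_mul_atTop (hu i))).eventually_gt_atTop 0
  obtain ⟨t, ht⟩ := hlarge.exists
  have h0 := aeval_linePoly p x u t
  have hcast : (fun i => (x i + u i * t : ℂ)) = fun i => ((x i + u i * t : ℝ) : ℂ) := by
    simp
  rw [h, hcast, MvPolynomial.aeval_ofReal] at h0
  simp only [map_zero] at h0
  exact (hpos _ ht).ne' (Complex.ofReal_eq_zero.mp h0.symm)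

/-- If `p : ℝⁿ → ℝ` is a positive hyperbolic polynomial — homogeneous of degree `m`,
positive on the positive orthant, and such that `t ↦ p(x + t u)` has `m` real roots
(counted with multiplicity) for every `u > 0` and every `x` — then every coefficient
of `p` is nonnegative. -/
theorem coeff_nonneg_of_positive_hyperbolic (n m : ℕ) (p : MvPolynomial (Fin n) ℝ)
    (hhom : p.IsHomogeneous m)
    (hpos : ∀ x : Fin n → ℝ, (∀ i, 0 < x i) → 0 < MvPolynomial.eval x p)
    (hroots : ∀ (u x : Fin n → ℝ), (∀ i, 0 < u i) →
      ((linePoly p x u).roots.card : ℕ) = m) :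
    ∀ d : Fin n →₀ ℕ, 0 ≤ p.coeff d := by
  refine IsPositiveStable.coeff_nonneg ⟨hhom, hpos, fun z hz h0 => ?_⟩
  have hline := aeval_linePoly p (fun i => (z i).re) (fun i => (z i).im) Complex.I
  have hne := linePoly_ne_zero hpos (fun i => (z i).re) hz
  have hcard := hroots (fun i => (z i).im) (fun i => (z i).re) hz
  set q := linePoly p (fun i => (z i).re) (fun i => (z i).im) with hq
  have hdeg : q.natDegree ≤ m := by
    have := MvPolynomial.aeval_natDegree_le p hhom.totalDegree_le
      (fun i => Polynomial.C (z i).re + Polynomial.C (z i).im * Polynomial.X) (n := 1)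
      fun i => by rw [add_comm]; exact Polynomial.natDegree_linear_le
    simpa [hq, linePoly] using this
  have hsplit : q.Splits := Polynomial.splits_iff_card_roots.mpr
    (le_antisymm (Polynomial.card_roots' q) (hcard ▸ hdeg))
  simp only [Complex.re_add_im, h0] at hline
  have hroot : (q.map (algebraMap ℝ ℂ)).IsRoot Complex.I := by
    rwa [Polynomial.IsRoot, Polynomial.eval_map_algebraMap]
  obtain ⟨r, hr⟩ := hsplit.mem_range_of_isRoot hne hroot
  simpa using congrArg Complex.im hr
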